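/- Let γ ∈ ℝ with γ ≠ 0. Suppose u : ℝ → ℂ is continuous on ℝ, twice continuously differentiable on ℝ\{0}, u and u' are square-integrable on ℝ and u'' is square-integrable on ℝ\{0}, the one-sided limits u'(0⁺), u'(0⁻) exist and satisfy u'(0⁺) - u'(0⁻) = -γ·u(0), and -u''(x) + ((|x| + γ/2)² - 3)·u(x) = 0 for every x ≠ 0. Then u is identically zero. -/

import Mathlib

open MeasureTheory Filter Set Topology

theorem exists_eqOn_const_Ioi_of_hasDerivAt_zero {f : ℝ → ℂ} {b : ℝ}
    (hf : ∀ x > b, HasDerivAt f 0 x) : ∃ c, ∀ x > b, f x = c := by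
  obtain ⟨c, hc⟩ := isOpen_Ioi.exists_is_const_of_deriv_eq_zero
    (isPreconnected_Ioi (a := b))
    (fun x hx => (hf x hx).differentiableAt.differentiableWithinAt)
    (fun x hx => (hf x hx).deriv)
  exact ⟨c, hc⟩

section HalfLine

variable {a : ℝ} {u w : ℝ → ℂ}

/-- A square-integrable solution of `(-d²/dx² + (x + a)² - 3) u = 0` on the half-line has vanishing
Wronskian with the decaying solution `(x + a) exp (-(x + a)² / 2)`. -/
theorem wronskian_eq_zero_of_integrableOn
    (hu : ∀ x > 0, HasDerivAt u (w x) x)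
    (hw : ∀ x > 0, HasDerivAt w ((((x + a) ^ 2 - 3 : ℝ) : ℂ) * u x) x)
    (hu2 : IntegrableOn (fun x => ‖u x‖ ^ 2) (Ioi 0))
    (hw2 : IntegrableOn (fun x => ‖w x‖ ^ 2) (Ioi 0)) {x : ℝ} (hx : 0 < x) :
    ((x + a : ℝ) : ℂ) * w x = ((1 - (x + a) ^ 2 : ℝ) : ℂ) * u x := by
  obtain ⟨c, hc⟩ := exists_eqOn_const_Ioi_of_hasDerivAt_zero (b := 0)
    (f := fun x => ((Real.exp (-(x + a) ^ 2 / 2) : ℝ) : ℂ) *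
      (((x + a : ℝ) : ℂ) * w x - ((1 - (x + a) ^ 2 : ℝ) : ℂ) * u x)) (by
    intro x hx
    have hy : HasDerivAt (fun x : ℝ => x + a) 1 x := (hasDerivAt_id x).add_const a
    have hE := (((hy.pow 2).neg.div_const 2).exp).ofReal_comp
    have hq := ((hy.pow 2).const_sub 1).ofReal_comp
    refine (hE.mul ((hy.ofReal_comp.mul (hw x hx)).sub (hq.mul (hu x hx)))).congr_deriv ?_
    simp
    ring)
  have hbound : ∀ x > 0, ‖c‖ ^ 2 ≤ 2 * ‖w x‖ ^ 2 + 8 * ‖u x‖ ^ 2 := by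
    intro x hx
    have hexp : Real.exp (-(x + a) ^ 2 / 2) * (1 + (x + a) ^ 2 / 2) ≤ 1 := by
      rw [neg_div, Real.exp_neg, inv_mul_le_iff₀ (Real.exp_pos _)]
      linarith [Real.add_one_le_exp ((x + a) ^ 2 / 2)]
    have hpos := Real.exp_pos (-(x + a) ^ 2 / 2)
    have hp : Real.exp (-(x + a) ^ 2 / 2) * |x + a| ≤ 1 := by
      refine le_trans (mul_le_mul_of_nonneg_left ?_ hpos.le) hexp
      nlinarith [sq_abs (x + a), sq_nonneg (|x + a| - 1)]
    have hq : Real.exp (-(x + a) ^ 2 / 2) * |1 - (x + a) ^ 2| ≤ 2 := by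
      have : |1 - (x + a) ^ 2| ≤ 2 * (1 + (x + a) ^ 2 / 2) := by
        rw [abs_le]
        constructor <;> nlinarith [sq_nonneg (x + a)]
      nlinarith [mul_le_mul_of_nonneg_left this hpos.le]
    have hcle : ‖c‖ ≤ ‖w x‖ + 2 * ‖u x‖ := by
      rw [← hc x hx, norm_mul, Complex.norm_of_nonneg hpos.le]
      have htri := norm_sub_le (((x + a : ℝ) : ℂ) * w x) (((1 - (x + a) ^ 2 : ℝ) : ℂ) * u x)
      rw [norm_mul, norm_mul, Complex.norm_real, Complex.norm_real, Real.norm_eq_abs,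
        Real.norm_eq_abs] at htri
      nlinarith [mul_le_mul_of_nonneg_left htri hpos.le,
        mul_le_mul_of_nonneg_right hp (norm_nonneg (w x)),
        mul_le_mul_of_nonneg_right hq (norm_nonneg (u x))]
    nlinarith [norm_nonneg c, norm_nonneg (w x), norm_nonneg (u x),
      sq_nonneg (‖w x‖ - 2 * ‖u x‖), pow_le_pow_left₀ (norm_nonneg c) hcle 2]
  have hint : IntegrableOn (fun _ : ℝ => ‖c‖ ^ 2) (Ioi 0) := by
    refine ((hw2.const_mul 2).add (hu2.const_mul 8)).mono' aestronglyMeasurable_const ?_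
    filter_upwards [ae_restrict_mem measurableSet_Ioi] with x hx
    simpa using hbound x hx
  have hc0 : c = 0 := by simpa [integrableOn_const_iff] using hint
  have h := hc x hx
  rw [hc0, mul_eq_zero, Complex.ofReal_eq_zero] at h
  exact sub_eq_zero.mp (h.resolve_left (Real.exp_ne_zero _))

/-- A solution of `(-d²/dx² + (x + a)² - 3) u = 0` on the half-line with vanishing Wronskian against
`(x + a) exp (-(x + a)² / 2)` and zero boundary data is zero. -/
theorem eq_zero_of_wronskian_eq_zero
    (hu : ∀ x > 0, HasDerivAt u (w x) x)
    (hw : ∀ x > 0, HasDerivAt w ((((x + a) ^ 2 - 3 : ℝ) : ℂ) * u x) x)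
    (hW : ∀ x > 0, ((x + a : ℝ) : ℂ) * w x = ((1 - (x + a) ^ 2 : ℝ) : ℂ) * u x)
    (hu0 : Tendsto u (𝓝[>] 0) (𝓝 0)) (hw0 : Tendsto w (𝓝[>] 0) (𝓝 0)) {x : ℝ} (hx : 0 < x) :
    u x = 0 := by
  obtain ⟨c, hc⟩ := exists_eqOn_const_Ioi_of_hasDerivAt_zero (b := 0)
    (f := fun x => ((Real.exp ((x + a) ^ 2 / 2) : ℝ) : ℂ) *
      (w x + ((x + a : ℝ) : ℂ) * u x)) (by
    intro x hx
    have hy : HasDerivAt (fun x : ℝ => x + a) 1 x := (hasDerivAt_id x).add_const a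
    have hE := (((hy.pow 2).div_const 2).exp).ofReal_comp
    refine (hE.mul ((hw x hx).add (hy.ofReal_comp.mul (hu x hx)))).congr_deriv ?_
    have h := hW x hx
    simp at h ⊢
    linear_combination 2 * Complex.exp (((x : ℂ) + a) ^ 2 / 2) * h)
  have hc0 : c = 0 := by
    have hE : Tendsto (fun x : ℝ => ((Real.exp ((x + a) ^ 2 / 2) : ℝ) : ℂ)) (𝓝[>] 0)
        (𝓝 ((Real.exp ((0 + a) ^ 2 / 2) : ℝ) : ℂ)) :=
      (Continuous.tendsto (by fun_prop) 0).mono_left nhdsWithin_le_nhds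
    have hy : Tendsto (fun x : ℝ => ((x + a : ℝ) : ℂ)) (𝓝[>] 0) (𝓝 ((0 + a : ℝ) : ℂ)) :=
      (Continuous.tendsto (by fun_prop) 0).mono_left nhdsWithin_le_nhds
    have hlim := hE.mul (hw0.add (hy.mul hu0))
    rw [mul_zero, add_zero, mul_zero] at hlim
    refine tendsto_nhds_unique (tendsto_const_nhds.congr' ?_) hlim
    filter_upwards [self_mem_nhdsWithin] with x hx using (hc x hx).symm
  have h := hc x hx
  rw [hc0, mul_eq_zero, Complex.ofReal_eq_zero] at h
  have hv := h.resolve_left (Real.exp_ne_zero _)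
  have hWx := hW x hx
  push_cast at hv hWx
  linear_combination ((x : ℂ) + a) * hv - hWx

/-- Boundary relation inherited from the vanishing of the Wronskian. -/
theorem boundary_relation_of_wronskian_eq_zero {u₀ w₀ : ℂ}
    (hW : ∀ x > 0, ((x + a : ℝ) : ℂ) * w x = ((1 - (x + a) ^ 2 : ℝ) : ℂ) * u x)
    (hu0 : Tendsto u (𝓝[>] 0) (𝓝 u₀)) (hw0 : Tendsto w (𝓝[>] 0) (𝓝 w₀)) :
    (a : ℂ) * w₀ = (1 - (a : ℂ) ^ 2) * u₀ := by
  have hy : Tendsto (fun x : ℝ => ((x + a : ℝ) : ℂ)) (𝓝[>] 0) (𝓝 ((0 + a : ℝ) : ℂ)) :=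
    (Continuous.tendsto (by fun_prop) 0).mono_left nhdsWithin_le_nhds
  have hq : Tendsto (fun x : ℝ => ((1 - (x + a) ^ 2 : ℝ) : ℂ)) (𝓝[>] 0)
      (𝓝 ((1 - (0 + a) ^ 2 : ℝ) : ℂ)) :=
    (Continuous.tendsto (by fun_prop) 0).mono_left nhdsWithin_le_nhds
  have heq : (fun x : ℝ => ((x + a : ℝ) : ℂ) * w x) =ᶠ[𝓝[>] 0]
      fun x => ((1 - (x + a) ^ 2 : ℝ) : ℂ) * u x := by
    filter_upwards [self_mem_nhdsWithin] with x hx using hW x hx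
  simpa using tendsto_nhds_unique ((hy.mul hw0).congr' heq) (hq.mul hu0)

end HalfLine

/-- The linearized operator `L₁^γ = -d²/dx² + (|x|+γ/2)² - 3` with δ-interaction jump
condition `u'(0⁺) - u'(0⁻) = -γu(0)` has trivial kernel for every `γ ≠ 0`. -/
theorem stmt7 (γ : ℝ) (hγ : γ ≠ 0) (u : ℝ → ℂ)
    (hcont : Continuous u)
    (hC2 : ContDiffOn ℝ 2 u {0}ᶜ)
    (huL2 : Integrable (fun x => ‖u x‖ ^ 2))
    (hu'L2 : Integrable (fun x => ‖deriv u x‖ ^ 2))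
    (hu''L2 : IntegrableOn (fun x => ‖deriv (deriv u) x‖ ^ 2) ({0}ᶜ))
    (Lp Lm : ℂ)
    (hLp : Tendsto (deriv u) (𝓝[>] (0 : ℝ)) (𝓝 Lp))
    (hLm : Tendsto (deriv u) (𝓝[<] (0 : ℝ)) (𝓝 Lm))
    (hjump : Lp - Lm = -(γ : ℂ) * u 0)
    (heq : ∀ x ≠ 0, -(deriv (deriv u) x)
      + (((|x| + γ / 2) ^ 2 - 3 : ℝ) : ℂ) * u x = 0) :
    ∀ x : ℝ, u x = 0 := by
  have hd : ∀ x ≠ 0, HasDerivAt u (deriv u x) x := fun x hx =>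
    ((hC2.differentiableOn (by norm_num)).differentiableAt
      (isOpen_compl_singleton.mem_nhds hx)).hasDerivAt
  have hdd : ∀ x ≠ 0,
      HasDerivAt (deriv u) ((((|x| + γ / 2) ^ 2 - 3 : ℝ) : ℂ) * u x) x := by
    intro x hx
    have hC1 : ContDiffOn ℝ 1 (deriv u) {0}ᶜ :=
      ((contDiffOn_succ_iff_deriv_of_isOpen (n := 1) isOpen_compl_singleton).1
        (by simpa [one_add_one_eq_two] using hC2)).2.2
    rw [← neg_add_eq_zero.mp (heq x hx)]
    exact ((hC1.differentiableOn one_ne_zero).differentiableAt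
      (isOpen_compl_singleton.mem_nhds hx)).hasDerivAt
  have hup : Tendsto u (𝓝[>] 0) (𝓝 (u 0)) := (hcont.tendsto 0).mono_left nhdsWithin_le_nhds
  have hneg : Tendsto (fun x : ℝ => -x) (𝓝[>] 0) (𝓝[<] 0) := by
    simpa using tendsto_neg_nhdsGT (a := (0 : ℝ))
  have hum : Tendsto (fun x => u (-x)) (𝓝[>] 0) (𝓝 (u 0)) :=
    ((hcont.tendsto 0).mono_left nhdsWithin_le_nhds).comp hneg
  have hwm : Tendsto (fun x => -deriv u (-x)) (𝓝[>] 0) (𝓝 (-Lm)) := (hLm.comp hneg).neg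
  have hdp : ∀ x > 0, HasDerivAt u (deriv u x) x := fun x hx => hd x hx.ne'
  have hddp : ∀ x > 0,
      HasDerivAt (deriv u) ((((x + γ / 2) ^ 2 - 3 : ℝ) : ℂ) * u x) x := by
    intro x hx
    simpa only [abs_of_pos hx] using hdd x hx.ne'
  have hdm : ∀ x > 0, HasDerivAt (fun x => u (-x)) (-deriv u (-x)) x := by
    intro x hx
    have h := (hd (-x) (neg_ne_zero.2 hx.ne')).scomp x (hasDerivAt_neg x)
    rw [neg_one_smul] at h
    exact h
  have hddm : ∀ x > 0, HasDerivAt (fun x => -deriv u (-x))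
      ((((x + γ / 2) ^ 2 - 3 : ℝ) : ℂ) * u (-x)) x := by
    intro x hx
    have h := ((hdd (-x) (neg_ne_zero.2 hx.ne')).scomp x (hasDerivAt_neg x)).neg
    rw [neg_one_smul, neg_neg, abs_neg, abs_of_pos hx] at h
    exact h
  have hWp : ∀ x > 0, ((x + γ / 2 : ℝ) : ℂ) * deriv u x =
      ((1 - (x + γ / 2) ^ 2 : ℝ) : ℂ) * u x := fun x hx =>
    wronskian_eq_zero_of_integrableOn hdp hddp huL2.integrableOn hu'L2.integrableOn hx
  have hWm : ∀ x > 0, ((x + γ / 2 : ℝ) : ℂ) * -deriv u (-x) =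
      ((1 - (x + γ / 2) ^ 2 : ℝ) : ℂ) * u (-x) := fun x hx =>
    wronskian_eq_zero_of_integrableOn hdm hddm huL2.comp_neg.integrableOn
      (by simpa using hu'L2.comp_neg.integrableOn) hx
  have hbp := boundary_relation_of_wronskian_eq_zero hWp hup hLp
  have hbm := boundary_relation_of_wronskian_eq_zero hWm hum hwm
  push_cast at hbp hbm
  have hγ' : (γ : ℂ) ≠ 0 := Complex.ofReal_ne_zero.2 hγ
  have h0 : u 0 = 0 := by linear_combination (γ / 4 : ℂ) * hjump - (hbp + hbm) / 2
  rw [h0, mul_zero] at hbp hbm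
  have hLp0 : Lp = 0 := by simpa [hγ'] using hbp
  have hLm0 : -Lm = 0 := by simpa [hγ'] using hbm
  rw [h0] at hup hum
  rw [hLp0] at hLp
  rw [hLm0] at hwm
  intro x
  rcases lt_trichotomy x 0 with hx | rfl | hx
  · simpa using eq_zero_of_wronskian_eq_zero hdm hddm hWm hum hwm (neg_pos.2 hx)
  · exact h0
  · exact eq_zero_of_wronskian_eq_zero hdp hddp hWp hup hLp hx
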